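/- Under the subcritically loaded scaling, for each i ∈ {1,…,C} one has E_{s_i^{(k)}}(λ^{(k)} α_i d_i) → 0 as k → ∞, and consequently ∑_{i=1}^C α_i · E_{s_i^{(k)}}(λ^{(k)} α_i d_i) → 0 as k → ∞. (The latter sum is an upper bound on the probability that an arriving job is routed to the helper set, so this is the analytic content of Theorem 1.) -/

import Mathlib

open Finset Filter Topology MeasureTheory

/-- Erlang's loss formula (Erlang-B): blocking probability of an M/GI/s/s queue
with offered load `a`. -/
noncomputable def erlangB (s : ℕ) (a : ℝ) : ℝ :=
  (a ^ s / Nat.factorial s) / ∑ ℓ ∈ Finset.range (s + 1), a ^ ℓ / Nat.factorial ℓ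

/-- Standard normal density φ. -/
noncomputable def stdGaussianPDF (x : ℝ) : ℝ :=
  Real.exp (-x ^ 2 / 2) / Real.sqrt (2 * Real.pi)

/-- Standard normal cumulative distribution function Φ. -/
noncomputable def stdGaussianCDF (x : ℝ) : ℝ :=
  ∫ t in Set.Iic x, stdGaussianPDF t

/-- Relative demand of class `i`: ϱ_i = α_i d_i n_i. -/
noncomputable def relDemand {C : ℕ} (n : Fin C → ℕ) (α d : Fin C → ℝ) (i : Fin C) : ℝ :=
  α i * d i * n i

/-- Total relative demand: ϱ = ∑ i, ϱ_i. -/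
noncomputable def totDemand {C : ℕ} (n : Fin C → ℕ) (α d : Fin C → ℝ) : ℝ :=
  ∑ i, relDemand n α d i

/-- ψ_k = sup { x ∈ [0,1] : k - ∑_i ⌊x · k ϱ_i/(n_i f_k ϱ)⌋ n_i f_k ≥ max_i n_i f_k },
with the convention `sSup ∅ = 0` of real numbers. -/
noncomputable def psi {C : ℕ} (n : Fin C → ℕ) (α d : Fin C → ℝ) (f : ℕ → ℕ) (k : ℕ) : ℝ :=
  sSup {x : ℝ | x ∈ Set.Icc (0 : ℝ) 1 ∧
    (k : ℝ) - ∑ i, (⌊x * ((k : ℝ) * relDemand n α d i /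
        ((n i : ℝ) * (f k : ℝ) * totDemand n α d))⌋ : ℝ) * ((n i : ℝ) * (f k : ℝ))
      ≥ ((Finset.univ.sup (fun i => n i * f k) : ℕ) : ℝ)}

/-- Number of class-`i` "virtual servers": s_i^(k) = ⌊ψ_k · k ϱ_i/(n_i f_k ϱ)⌋. -/
noncomputable def srv {C : ℕ} (n : Fin C → ℕ) (α d : Fin C → ℝ) (f : ℕ → ℕ)
    (i : Fin C) (k : ℕ) : ℕ :=
  ⌊psi n α d f k * ((k : ℝ) * relDemand n α d i /
      ((n i : ℝ) * (f k : ℝ) * totDemand n α d))⌋₊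

/-- θ_i = θ √(ϱ_i/(n_i ϱ)). -/
noncomputable def thetaI {C : ℕ} (n : Fin C → ℕ) (α d : Fin C → ℝ) (θ : ℝ) (i : Fin C) : ℝ :=
  θ * Real.sqrt (relDemand n α d i / ((n i : ℝ) * totDemand n α d))

/-- For `0 ≤ a`, the last term of the truncated exponential series times `s - a` is bounded by
the whole truncated series. -/
lemma sub_mul_pow_div_factorial_le_sum {a : ℝ} (ha : 0 ≤ a) (s : ℕ) :
    ((s : ℝ) - a) * (a ^ s / Nat.factorial s) ≤
      ∑ ℓ ∈ Finset.range (s + 1), a ^ ℓ / Nat.factorial ℓ := by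
  induction s with
  | zero => simp; linarith
  | succ s ih =>
    rw [Finset.sum_range_succ]
    set S := ∑ ℓ ∈ Finset.range (s + 1), a ^ ℓ / (Nat.factorial ℓ : ℝ)
    have hS : 0 ≤ S := Finset.sum_nonneg fun ℓ _ => by positivity
    have hT : 0 ≤ a ^ s / (Nat.factorial s : ℝ) := by positivity
    have hT' : 0 ≤ a ^ (s + 1) / (Nat.factorial (s + 1) : ℝ) := by positivity
    have hrec : ((s : ℝ) + 1) * (a ^ (s + 1) / (Nat.factorial (s + 1) : ℝ)) =
        a * (a ^ s / (Nat.factorial s : ℝ)) := by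
      rw [Nat.factorial_succ]
      push_cast
      field_simp
      ring
    set T := a ^ s / (Nat.factorial s : ℝ)
    set T' := a ^ (s + 1) / (Nat.factorial (s + 1) : ℝ)
    push_cast
    rcases le_total a s with h | h
    · have hle : T' ≤ T := by
        have : ((s : ℝ) + 1) * T' ≤ ((s : ℝ) + 1) * T := by
          rw [hrec]
          exact mul_le_mul_of_nonneg_right (by linarith) hT
        exact le_of_mul_le_mul_left this (by positivity)
      have := mul_le_mul_of_nonneg_left hle (sub_nonneg.2 h)
      linarith
    · have := mul_nonneg (sub_nonneg.2 h) hT'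
      linarith

lemma erlangB_nonneg {a : ℝ} (ha : 0 ≤ a) (s : ℕ) : 0 ≤ erlangB s a :=
  div_nonneg (by positivity) (Finset.sum_nonneg fun ℓ _ => by positivity)

lemma erlangB_le_inv_sub {a : ℝ} {s : ℕ} (ha : 0 ≤ a) (has : a < s) :
    erlangB s a ≤ ((s : ℝ) - a)⁻¹ := by
  have hpos : 0 < ∑ ℓ ∈ Finset.range (s + 1), a ^ ℓ / (Nat.factorial ℓ : ℝ) :=
    Finset.sum_pos' (fun ℓ _ => by positivity) ⟨0, by simp, by simp⟩
  rw [erlangB, div_le_iff₀ hpos, inv_mul_eq_div, le_div_iff₀ (sub_pos.2 has), mul_comm]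
  exact sub_mul_pow_div_factorial_le_sum ha s

lemma tendsto_erlangB_zero {ι : Type*} {l : Filter ι} {s : ι → ℕ} {a : ι → ℝ}
    (ha : ∀ᶠ k in l, 0 ≤ a k) (h : Tendsto (fun k => (s k : ℝ) - a k) l atTop) :
    Tendsto (fun k => erlangB (s k) (a k)) l (𝓝 0) := by
  refine tendsto_of_tendsto_of_tendsto_of_le_of_le' tendsto_const_nhds
    h.inv_tendsto_atTop ?_ ?_
  · filter_upwards [ha] with k hk using erlangB_nonneg hk _
  · filter_upwards [ha, h.eventually_gt_atTop 0] with k hk hk'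
    exact erlangB_le_inv_sub hk (sub_pos.1 hk')

lemma totDemand_pos {C : ℕ} (hC : 0 < C) {n : Fin C → ℕ} (hn : ∀ i, 0 < n i)
    {α d : Fin C → ℝ} (hα : ∀ i, 0 < α i) (hd : ∀ i, 0 < d i) : 0 < totDemand n α d :=
  haveI : Nonempty (Fin C) := ⟨⟨0, hC⟩⟩
  Finset.sum_pos (fun i _ => mul_pos (mul_pos (hα i) (hd i)) (Nat.cast_pos.2 (hn i)))
    Finset.univ_nonempty

/-- The scaling factor `ψ_k` is at least any `c ∈ [0,1]` that leaves room for the largest job. -/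
lemma le_psi {C : ℕ} {n : Fin C → ℕ} (hn : ∀ i, 0 < n i) {α d : Fin C → ℝ}
    (hϱ : 0 < totDemand n α d) {f : ℕ → ℕ} {k : ℕ} (hf : 0 < f k) {c : ℝ} (hc0 : 0 ≤ c)
    (hc1 : c ≤ 1)
    (hck : ((Finset.univ.sup (fun i => n i * f k) : ℕ) : ℝ) ≤ (1 - c) * k) :
    c ≤ psi n α d f k := by
  refine le_csSup ⟨1, fun x hx => hx.1.2⟩ ⟨⟨hc0, hc1⟩, ?_⟩
  have hf' : (0 : ℝ) < f k := Nat.cast_pos.2 hf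
  have hle : ∑ i, (⌊c * ((k : ℝ) * relDemand n α d i /
      ((n i : ℝ) * (f k : ℝ) * totDemand n α d))⌋ : ℝ) * ((n i : ℝ) * (f k : ℝ)) ≤
      ∑ i, c * k / totDemand n α d * relDemand n α d i := by
    refine Finset.sum_le_sum fun i _ => ?_
    have hni : (0 : ℝ) < n i := Nat.cast_pos.2 (hn i)
    refine (mul_le_mul_of_nonneg_right (Int.floor_le _) (by positivity)).trans_eq ?_
    field_simp
  have hsum : ∑ i, c * k / totDemand n α d * relDemand n α d i = c * k := by
    rw [← Finset.mul_sum]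
    exact div_mul_cancel₀ _ hϱ.ne'
  linarith

lemma eventually_le_psi {C : ℕ} {n : Fin C → ℕ} (hn : ∀ i, 0 < n i) {α d : Fin C → ℝ}
    (hϱ : 0 < totDemand n α d) {f : ℕ → ℕ} (hf : ∀ k, 0 < f k)
    (hfk : Tendsto (fun k : ℕ => (f k : ℝ) / k) atTop (𝓝 0)) {c : ℝ} (hc0 : 0 ≤ c)
    (hc1 : c < 1) : ∀ᶠ k in atTop, c ≤ psi n α d f k := by
  have hlim : Tendsto (fun k : ℕ => ((Finset.univ.sup n : ℕ) : ℝ) * ((f k : ℝ) / k))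
      atTop (𝓝 0) := by
    simpa using hfk.const_mul ((Finset.univ.sup n : ℕ) : ℝ)
  filter_upwards [hlim.eventually_lt_const (sub_pos.2 hc1), eventually_gt_atTop 0] with k hk hk0
  refine le_psi hn hϱ (hf k) hc0 hc1.le ?_
  have hsup : Finset.univ.sup (fun i => n i * f k) ≤ Finset.univ.sup n * f k :=
    Finset.sup_le fun i hi => Nat.mul_le_mul_right _ (Finset.le_sup hi)
  have hk0' : (0 : ℝ) < k := Nat.cast_pos.2 hk0
  rw [← mul_div_assoc, div_lt_iff₀ hk0'] at hk
  exact le_trans (by exact_mod_cast hsup) hk.le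

/-- The surplus of class-`i` servers over the offered load diverges in the subcritical regime. -/
lemma tendsto_srv_sub_load_atTop {C : ℕ} {n : Fin C → ℕ} (hn : ∀ i, 0 < n i) {α d : Fin C → ℝ}
    (hα : ∀ i, 0 < α i) (hd : ∀ i, 0 < d i) (hϱ : 0 < totDemand n α d)
    {f : ℕ → ℕ} (hf : ∀ k, 0 < f k)
    (hfk : Tendsto (fun k : ℕ => (f k : ℝ) / k) atTop (𝓝 0))
    {lam : ℝ} (hlam : 0 < lam) (hsub : lam * totDemand n α d < 1) (i : Fin C) :
    Tendsto (fun k : ℕ => (srv n α d f i k : ℝ) - lam * k / f k * α i * d i) atTop atTop := by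
  obtain ⟨c, hc, hc1⟩ := exists_between hsub
  have hc0 : 0 ≤ c := (mul_pos hlam hϱ).le.trans hc.le
  have hratio : Tendsto (fun k : ℕ => (k : ℝ) / f k) atTop atTop := by
    have hpos : ∀ᶠ k : ℕ in atTop, (f k : ℝ) / k ∈ Set.Ioi (0 : ℝ) := by
      filter_upwards [eventually_gt_atTop 0] with k hk
      have hk' : (0 : ℝ) < k := Nat.cast_pos.2 hk
      exact div_pos (Nat.cast_pos.2 (hf k)) hk'
    simpa [Function.comp_def] using
      tendsto_inv_nhdsGT_zero.comp (tendsto_nhdsWithin_iff.2 ⟨hfk, hpos⟩)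
  have hcoef : 0 < (c - lam * totDemand n α d) * (α i * d i / totDemand n α d) :=
    mul_pos (sub_pos.2 hc) (div_pos (mul_pos (hα i) (hd i)) hϱ)
  refine tendsto_atTop_mono' _ ?_
    (tendsto_atTop_add_const_right _ (-1 : ℝ) (hratio.const_mul_atTop hcoef))
  filter_upwards [eventually_le_psi hn hϱ hf hfk hc0 hc1] with k hk
  have hni : (0 : ℝ) < n i := Nat.cast_pos.2 (hn i)
  have hfk' : (0 : ℝ) < f k := Nat.cast_pos.2 (hf k)
  have hq : (k : ℝ) * relDemand n α d i / ((n i : ℝ) * (f k : ℝ) * totDemand n α d) =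
      α i * d i / totDemand n α d * (k / f k) := by
    rw [relDemand]
    field_simp
  have hfloor := Nat.lt_floor_add_one (psi n α d f k * ((k : ℝ) * relDemand n α d i /
    ((n i : ℝ) * (f k : ℝ) * totDemand n α d)))
  rw [← srv, hq] at hfloor
  have hq0 : 0 ≤ α i * d i / totDemand n α d * (k / f k) :=
    mul_nonneg (div_pos (mul_pos (hα i) (hd i)) hϱ).le (by positivity)
  have hmul := mul_le_mul_of_nonneg_right hk hq0
  have hload : lam * k / f k * α i * d i =
      lam * totDemand n α d * (α i * d i / totDemand n α d * (k / f k)) := by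
    field_simp
  rw [hload]
  linarith

/-- In the subcritically loaded regime, each per-class Erlang blocking probability
vanishes, and consequently so does the helper-set routing probability bound. -/
theorem subcritical_blocking_vanishes
    (C : ℕ) (hC : 0 < C) (n : Fin C → ℕ) (hn : ∀ i, 0 < n i)
    (α d : Fin C → ℝ) (hα : ∀ i, 0 < α i) (hd : ∀ i, 0 < d i)
    (hsum : ∑ i, α i = 1)
    (f : ℕ → ℕ) (hf : ∀ k, 0 < f k)
    (hfk : Tendsto (fun k : ℕ => (f k : ℝ) / k) atTop (𝓝 0))
    (lam : ℝ) (hlam : 0 < lam) (hsub : lam * totDemand n α d < 1) :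
    (∀ i : Fin C,
      Tendsto (fun k : ℕ => erlangB (srv n α d f i k) (lam * k / f k * α i * d i))
        atTop (𝓝 0)) ∧
    Tendsto
      (fun k : ℕ => ∑ i, α i * erlangB (srv n α d f i k) (lam * k / f k * α i * d i))
      atTop (𝓝 0) := by
  have hϱ := totDemand_pos hC hn hα hd
  have hclass : ∀ i : Fin C,
      Tendsto (fun k : ℕ => erlangB (srv n α d f i k) (lam * k / f k * α i * d i))
        atTop (𝓝 0) := fun i =>
    tendsto_erlangB_zero
      (Eventually.of_forall fun k => by have := hα i; have := hd i; positivity)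
      (tendsto_srv_sub_load_atTop hn hα hd hϱ hf hfk hlam hsub i)
  refine ⟨hclass, ?_⟩
  simpa using tendsto_finsetSum Finset.univ fun i _ => (hclass i).const_mul (α i)
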